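/- arXiv:2306.14049 — 5 statements merged into one kernel-verified Lean document; each statement's English description precedes it below -/
import Mathlib

section
/- Let d = 2 or d = 3 and let B be a symmetric positive-definite d×d real matrix. With respect to the Frobenius inner product ⟨A,C⟩ = tr(A Cᵀ) on d×d real matrices, the orthogonal complement of the subspace 𝒞_B = {M : Mᵀ = M and M B = B M} equals the sum of the subspace 𝒜 of anti-symmetric matrices and the subspace 𝒦_B = {M : M B + B Mᵀ = 0}. Concretely: a d×d real matrix M satisfies tr(M Nᵀ) = 0 for every symmetric N commuting with B if and only if M = X + Y for some matrices X, Y with Xᵀ = −X and Y B + B Yᵀ = 0. -/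
open Matrix

theorem aux_diag {d : ℕ} (B : Matrix (Fin d) (Fin d) ℝ) (hBsym : Bᵀ = B) :
    ∃ (U : Matrix (Fin d) (Fin d) ℝ) (e : Fin d → ℝ),
      Uᵀ * U = 1 ∧ U * Uᵀ = 1 ∧ B = U * diagonal e * Uᵀ := by
  have hB : B.IsHermitian := by
    rw [Matrix.IsHermitian, conjTranspose_eq_transpose_of_trivial, hBsym]
  refine ⟨hB.eigenvectorUnitary, hB.eigenvalues, ?_, ?_, ?_⟩
  · have := Unitary.coe_star_mul_self hB.eigenvectorUnitary
    rwa [star_eq_conjTranspose, conjTranspose_eq_transpose_of_trivial] at this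
  · have := Unitary.coe_mul_star_self hB.eigenvectorUnitary
    rwa [Unitary.coe_star, star_eq_conjTranspose, conjTranspose_eq_transpose_of_trivial] at this
  · have := hB.spectral_theorem
    rw [Unitary.conjStarAlgAut_apply, star_eq_conjTranspose,
      conjTranspose_eq_transpose_of_trivial] at this
    exact this

theorem aux_fwd {d : ℕ} (B M : Matrix (Fin d) (Fin d) ℝ) (hBsym : Bᵀ = B)
    (h : ∀ N : Matrix (Fin d) (Fin d) ℝ, Nᵀ = N → N * B = B * N → (M * Nᵀ).trace = 0) :
    ∃ X Y : Matrix (Fin d) (Fin d) ℝ,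
        Xᵀ = -X ∧ Y * B + B * Yᵀ = 0 ∧ M = X + Y := by
  obtain ⟨U, e, h1, h2, hB⟩ := aux_diag B hBsym
  have c1 : ∀ Z, Uᵀ * (U * Z) = Z := fun Z => by rw [← Matrix.mul_assoc, h1, Matrix.one_mul]
  have c2 : ∀ Z, U * (Uᵀ * Z) = Z := fun Z => by rw [← Matrix.mul_assoc, h2, Matrix.one_mul]
  set A := Uᵀ * M * U with hA
  have hM : M = U * A * Uᵀ := by
    simp only [hA, Matrix.mul_assoc, c2, h2, Matrix.mul_one]
  have key : ∀ i j, e i = e j → A i j + A j i = 0 := by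
    intro i j hij
    have := h (U * (single i j 1 + single j i 1) * Uᵀ)
      (by simp [Matrix.mul_assoc, add_comm])
      (by
        have hc : (single i j 1 + single j i 1) * diagonal e
            = diagonal e * (single i j (1:ℝ) + single j i 1) := by
          ext a b
          simp only [mul_diagonal, diagonal_mul, Matrix.add_apply, single_apply]
          by_cases hab : e a = e b
          · rw [hab, mul_comm]
          · have n1 : ¬ (i = a ∧ j = b) := by
              rintro ⟨rfl, rfl⟩
              exact hab hij
            have n2 : ¬ (j = a ∧ i = b) := by
              rintro ⟨rfl, rfl⟩
              exact hab hij.symm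
            rw [if_neg n1, if_neg n2]
            ring
        rw [hB]
        simp only [Matrix.mul_assoc, c1]
        rw [← Matrix.mul_assoc _ (diagonal e), hc, Matrix.mul_assoc])
    rw [hM] at this
    simp only [transpose_mul, transpose_transpose, transpose_add, transpose_single,
      Matrix.mul_assoc, c1] at this
    rw [Matrix.trace_mul_comm] at this
    simp only [Matrix.mul_assoc, h1, Matrix.mul_one, Matrix.mul_add, trace_add,
      Matrix.trace_mul_single] at this
    simpa [add_comm] using this
  set Y' : Matrix (Fin d) (Fin d) ℝ :=
    Matrix.of fun i j => (A i j + A j i) * e i / (e i - e j) with hY'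
  have k1 : Y' + Y'ᵀ = A + Aᵀ := by
    ext i j
    simp only [hY', Matrix.add_apply, transpose_apply, of_apply]
    by_cases hij : e i = e j
    · simp [hij, key i j hij]
    · have a1 : e i - e j ≠ 0 := sub_ne_zero.2 hij
      rw [← neg_sub (e i) (e j)]
      field_simp
      ring
  have k2 : Y' * diagonal e + diagonal e * Y'ᵀ = 0 := by
    ext i j
    simp only [hY', Matrix.add_apply, transpose_apply, of_apply, mul_diagonal, diagonal_mul,
      Matrix.zero_apply]
    by_cases hij : e i = e j
    · simp [hij]
    · have a1 : e i - e j ≠ 0 := sub_ne_zero.2 hij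
      rw [← neg_sub (e i) (e j)]
      field_simp
      ring
  refine ⟨M - U * Y' * Uᵀ, U * Y' * Uᵀ, ?_, ?_, by simp⟩
  · have : U * (Y' + Y'ᵀ) * Uᵀ = U * (A + Aᵀ) * Uᵀ := by rw [k1]
    rw [hM]
    simp only [Matrix.mul_add, Matrix.add_mul] at this
    simp only [transpose_sub, transpose_mul, transpose_transpose, ← Matrix.mul_assoc]
    rw [neg_sub, sub_eq_sub_iff_add_eq_add, add_comm, ← this, add_comm] <;> abel
  · have : U * (Y' * diagonal e + diagonal e * Y'ᵀ) * Uᵀ = 0 := by rw [k2]; simp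
    rw [hB, ← this]
    simp only [Matrix.mul_add, Matrix.add_mul, transpose_mul, transpose_transpose,
      Matrix.mul_assoc, c1]

theorem aux_bwd {d : ℕ} (B X Y N : Matrix (Fin d) (Fin d) ℝ) (hBsym : Bᵀ = B)
    (hB : IsUnit B.det) (hX : Xᵀ = -X) (hY : Y * B + B * Yᵀ = 0) (hN : Nᵀ = N)
    (hc : N * B = B * N) : ((X + Y) * Nᵀ).trace = 0 := by
  have t1 : (X * N).trace = 0 := by
    have : (X * N).trace = -(X * N).trace := by
      conv_lhs => rw [← trace_transpose, transpose_mul, hX, hN, Matrix.mul_neg, trace_neg,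
        trace_mul_comm]
    linarith
  have t2 : (Y * N).trace = 0 := by
    have hP : (B⁻¹ * N)ᵀ = B⁻¹ * N := by
      rw [transpose_mul, transpose_nonsing_inv, hBsym, hN]
      calc N * B⁻¹ = B⁻¹ * (B * N) * B⁻¹ := by
            rw [← Matrix.mul_assoc, nonsing_inv_mul _ hB, Matrix.one_mul]
        _ = B⁻¹ * N := by
            rw [← hc, Matrix.mul_assoc, Matrix.mul_assoc, mul_nonsing_inv _ hB, Matrix.mul_one]
    have hn : Y * N = (Y * B) * (B⁻¹ * N) := by
      rw [Matrix.mul_assoc, ← Matrix.mul_assoc B, mul_nonsing_inv _ hB, Matrix.one_mul]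
    have hW : (Y * B)ᵀ = -(Y * B) := by
      rw [transpose_mul, hBsym]; exact (neg_eq_of_add_eq_zero_right hY).symm
    have : ((Y * B) * (B⁻¹ * N)).trace = -((Y * B) * (B⁻¹ * N)).trace := by
      conv_lhs => rw [← trace_transpose, transpose_mul, hW, hP, Matrix.mul_neg, trace_neg,
        trace_mul_comm]
    rw [hn]
    linarith
  rw [hN, Matrix.add_mul, trace_add, t1, t2, add_zero]

/-- For `d = 2` or `d = 3` and `B` symmetric positive definite, a matrix `M`
is Frobenius-orthogonal to every symmetric matrix commuting with `B` iff it decomposes as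
the sum of an anti-symmetric matrix and an element of `𝒦_B = {Y | Y B + B Yᵀ = 0}`. -/
theorem frobenius_orthogonal_complement_of_commutant
    (d : ℕ) (hd : d = 2 ∨ d = 3)
    (B M : Matrix (Fin d) (Fin d) ℝ)
    (hBsym : Bᵀ = B)
    (hBpos : ∀ x : Fin d → ℝ, x ≠ 0 → 0 < x ⬝ᵥ B.mulVec x) :
    (∀ N : Matrix (Fin d) (Fin d) ℝ, Nᵀ = N → N * B = B * N → (M * Nᵀ).trace = 0) ↔
      ∃ X Y : Matrix (Fin d) (Fin d) ℝ,
        Xᵀ = -X ∧ Y * B + B * Yᵀ = 0 ∧ M = X + Y := by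
  constructor
  · exact aux_fwd B M hBsym
  · rintro ⟨X, Y, hX, hY, rfl⟩ N hN hc
    have hdet : IsUnit B.det := by
      rw [isUnit_iff_ne_zero]
      intro h0
      obtain ⟨v, hv, hv0⟩ := Matrix.exists_mulVec_eq_zero_iff.2 h0
      have := hBpos v hv
      rw [hv0] at this
      simp at this
    exact aux_bwd B X Y N hBsym hdet hX hY hN hc
end

section
/- (Derivative of the squared logarithmic strain.) Let C, L : ℝ → Mat_d(ℝ) be differentiable functions such that for every t the matrix L(t) is symmetric, C(t) is invertible, and exp(L(t)) = C(t) (so L = log C). Then for every t, d/dt ‖L(t)‖_F² = 2 tr( C′(t) · C(t)⁻¹ · L(t) ), where ‖M‖_F² = tr(M Mᵀ) is the squared Frobenius norm. -/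
open Matrix

/-- The matrix exponential `exp S = Σ_{k ≥ 0} S^k / k!` of a real `d × d` matrix. -/
noncomputable def matExp (d : ℕ) (S : Matrix (Fin d) (Fin d) ℝ) :
    Matrix (Fin d) (Fin d) ℝ :=
  ∑' k : ℕ, ((Nat.factorial k : ℝ))⁻¹ • S ^ k

section Abstract

set_option linter.unusedSectionVars false

variable {A : Type*} [NormedRing A] [NormedAlgebra ℝ A] [CompleteSpace A]

lemma aux_norm_pow_mul (a y : A) (n : ℕ) : ‖a ^ n * y‖ ≤ ‖a‖ ^ n * ‖y‖ := by
  induction n with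
  | zero => simp
  | succ n ih =>
    rw [pow_succ', mul_assoc, pow_succ', mul_assoc]
    exact (norm_mul_le _ _).trans (by gcongr)

lemma aux_norm_mul_pow (a y : A) (n : ℕ) : ‖y * a ^ n‖ ≤ ‖y‖ * ‖a‖ ^ n := by
  induction n with
  | zero => simp
  | succ n ih =>
    rw [pow_succ, ← mul_assoc, pow_succ, ← mul_assoc]
    exact (norm_mul_le _ _).trans (by gcongr)

lemma aux_summable (R : ℝ) :
    Summable (fun k : ℕ => ((Nat.factorial k : ℝ))⁻¹ * (k * R ^ (k - 1))) := by
  rw [← summable_nat_add_iff 1]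
  refine (Real.summable_pow_div_factorial R).congr fun k => ?_
  rw [Nat.factorial_succ]
  push_cast
  have h1 : (k : ℝ) + 1 ≠ 0 := by positivity
  have h2 : (Nat.factorial k : ℝ) ≠ 0 := by positivity
  field_simp

open scoped RightActions in
lemma aux_hasFDerivAt (a : A) :
    ∃ D : A →L[ℝ] A, HasFDerivAt (fun x : A => ∑' k : ℕ, ((Nat.factorial k : ℝ))⁻¹ • x ^ k) D a ∧
      ∀ h, HasSum (fun k : ℕ => ((Nat.factorial k : ℝ))⁻¹ •
        ∑ i ∈ Finset.range k, a ^ (k - 1 - i) * h * a ^ i) (D h) := by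
  let f' : ℕ → A → (A →L[ℝ] A) := fun k x => ((Nat.factorial k : ℝ))⁻¹ •
    ∑ i ∈ Finset.range k, x ^ (k.pred - i) •> ContinuousLinearMap.id ℝ A <• x ^ i
  have hf'_apply : ∀ k x h, f' k x h = ((Nat.factorial k : ℝ))⁻¹ •
        ∑ i ∈ Finset.range k, x ^ (k - 1 - i) * h * x ^ i := by
    intro k x h
    simp [f', mul_assoc]
  have hbound : ∀ k x, x ∈ Metric.ball (0 : A) (‖a‖ + 1) →
      ‖f' k x‖ ≤ ((Nat.factorial k : ℝ))⁻¹ * (k * (‖a‖ + 1) ^ (k - 1)) := by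
    intro k x hx
    have hx' : ‖x‖ ≤ ‖a‖ + 1 := by simpa using (le_of_lt (mem_ball_zero_iff.mp hx))
    refine ContinuousLinearMap.opNorm_le_bound _ (by positivity) fun h => ?_
    rw [hf'_apply, norm_smul, norm_inv, Real.norm_natCast, mul_assoc]
    gcongr
    have : ∀ i ∈ Finset.range k, ‖x ^ (k - 1 - i) * h * x ^ i‖ ≤ (‖a‖ + 1) ^ (k - 1) * ‖h‖ := by
      intro i hi
      have hik : k - 1 = (k - 1 - i) + i := by
        have := Finset.mem_range.mp hi
        omega
      calc ‖x ^ (k - 1 - i) * h * x ^ i‖ ≤ ‖x ^ (k - 1 - i) * h‖ * ‖x‖ ^ i := aux_norm_mul_pow _ _ _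
        _ ≤ (‖x‖ ^ (k - 1 - i) * ‖h‖) * ‖x‖ ^ i := by gcongr; exact aux_norm_pow_mul _ _ _
        _ = ‖x‖ ^ (k - 1) * ‖h‖ := by
          conv_rhs => rw [hik, pow_add]
          ring
        _ ≤ _ := by gcongr
    refine (norm_sum_le_of_le _ this).trans ?_
    simp [mul_assoc]
  have ha : a ∈ Metric.ball (0 : A) (‖a‖ + 1) := by simp
  have hs := aux_summable (‖a‖ + 1)
  refine ⟨∑' k, f' k a, ?_, ?_⟩
  · refine hasFDerivAt_tsum_of_isPreconnected hs Metric.isOpen_ball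
      (convex_ball _ _).isPreconnected (fun k x _ => ?_) hbound ha ?_ ha
    · exact (hasFDerivAt_pow' (𝕜 := ℝ) k (x := x)).const_smul ((Nat.factorial k : ℝ))⁻¹
    · exact (NormedSpace.norm_expSeries_summable' (𝕂 := ℝ) a).of_norm
  · intro h
    have h1 : Summable (fun k => f' k a) := Summable.of_norm_bounded hs fun k => hbound k a ha
    have h2 := (ContinuousLinearMap.apply ℝ A h).hasSum h1.hasSum
    simpa only [Function.comp_def, ContinuousLinearMap.apply_apply, hf'_apply] using h2

lemma aux_trace_deriv (T : A →L[ℝ] ℝ) (hT : ∀ x y, T (x * y) = T (y * x)) (a b : A)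
    (hab : a * b = b * a) (D : A →L[ℝ] A)
    (hD : ∀ h, HasSum (fun k : ℕ => ((Nat.factorial k : ℝ))⁻¹ •
        ∑ i ∈ Finset.range k, a ^ (k - 1 - i) * h * a ^ i) (D h)) (h : A) :
    T (D h * b) = T ((∑' k : ℕ, ((Nat.factorial k : ℝ))⁻¹ • a ^ k) * h * b) := by
  have h1 := T.hasSum ((hD h).mul_right b)
  have h2 := T.hasSum ((((NormedSpace.norm_expSeries_summable' (𝕂 := ℝ) a).of_norm.hasSum).mul_right
    h).mul_right b)
  have hterm : ∀ k : ℕ, T ((((Nat.factorial k : ℝ))⁻¹ •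
        ∑ i ∈ Finset.range k, a ^ (k - 1 - i) * h * a ^ i) * b) =
        ((Nat.factorial k : ℝ))⁻¹ * (k * T (a ^ (k - 1) * h * b)) := by
    intro k
    rw [smul_mul_assoc, map_smul, smul_eq_mul, Finset.sum_mul, map_sum]
    congr 1
    rw [Finset.sum_congr rfl (g := fun _ => T (a ^ (k - 1) * h * b)), Finset.sum_const,
      Finset.card_range, nsmul_eq_mul]
    intro i hi
    have hik : k - 1 = i + (k - 1 - i) := by
      have := Finset.mem_range.mp hi
      omega
    have hc : a ^ i * b = b * a ^ i := (Commute.pow_left (show Commute a b from hab) i)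
    rw [mul_assoc _ (a ^ i) b, hc, ← mul_assoc, hT _ (a ^ i), ← mul_assoc, ← mul_assoc, ← pow_add,
      ← hik]
  rw [← hasSum_nat_add_iff' 1] at h1
  refine HasSum.unique ?_ h2
  simp only [hterm, Function.comp_def] at h1
  simp only [Finset.range_one, Finset.sum_singleton, Nat.cast_zero, zero_mul, mul_zero, sub_zero]
    at h1
  convert h1 using 2 with k
  · rfl
  simp only [Function.comp_def, smul_mul_assoc, map_smul, smul_eq_mul, Nat.add_sub_cancel]
  rw [Nat.factorial_succ]
  push_cast
  have h1 : (k : ℝ) + 1 ≠ 0 := by positivity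
  have h2 : (Nat.factorial k : ℝ) ≠ 0 := by positivity
  field_simp

/-- If `e = ∑ a^k/k!` along a curve, then the derivative satisfies the trace identity. -/
lemma aux_main (T : A →L[ℝ] ℝ) (hT : ∀ x y, T (x * y) = T (y * x)) (C L : ℝ → A) (C' L' : A) (t : ℝ)
    (hC : HasDerivAt C C' t) (hL : HasDerivAt L L' t)
    (hexp : ∀ s, ∑' k : ℕ, ((Nat.factorial k : ℝ))⁻¹ • L s ^ k = C s) (b : A)
    (hb : L t * b = b * L t) : T (C' * b) = T (C t * L' * b) := by
  obtain ⟨D, hD, hD'⟩ := aux_hasFDerivAt (L t)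
  have h1 := hD.comp_hasDerivAt t hL
  have h2 : C' = D L' := by
    refine hC.unique (h1.congr_of_eventuallyEq (Filter.Eventually.of_forall fun s => ?_))
    exact (hexp s).symm
  rw [h2, aux_trace_deriv T hT (L t) b hb D hD', hexp]

lemma aux_commute (a c : A) (h : ∑' k : ℕ, ((Nat.factorial k : ℝ))⁻¹ • a ^ k = c) :
    a * c = c * a := by
  have hs : Summable fun k : ℕ => ((Nat.factorial k : ℝ))⁻¹ • a ^ k :=
    (NormedSpace.norm_expSeries_summable' (𝕂 := ℝ) a).of_norm
  rw [← h, ← hs.tsum_mul_left, ← hs.tsum_mul_right]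
  refine tsum_congr fun k => ?_
  rw [mul_smul_comm, smul_mul_assoc, ← pow_succ', pow_succ]

end Abstract

section Mat

attribute [local instance] Matrix.linftyOpNormedRing Matrix.linftyOpNormedAlgebra

lemma aux_mat (d : ℕ) (C L : ℝ → Matrix (Fin d) (Fin d) ℝ) (C' L' : Matrix (Fin d) (Fin d) ℝ) (t : ℝ)
    (hC : ∀ i j, HasDerivAt (fun s => C s i j) (C' i j) t)
    (hL : ∀ i j, HasDerivAt (fun s => L s i j) (L' i j) t)
    (hinv : IsUnit (C t).det)
    (hexp : ∀ t, matExp d (L t) = C t) :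
    (C' * (C t)⁻¹ * L t).trace = (L' * L t).trace := by
  have key : ∀ (F : ℝ → Matrix (Fin d) (Fin d) ℝ) (F' : Matrix (Fin d) (Fin d) ℝ),
      (∀ i j, HasDerivAt (fun s => F s i j) (F' i j) t) → HasDerivAt F F' t := by
    intro F F' h
    have h1 : HasDerivAt (fun s => ∑ i, ∑ j, F s i j • Matrix.single i j (1 : ℝ))
        (∑ i, ∑ j, F' i j • Matrix.single i j (1 : ℝ)) t :=
      HasDerivAt.fun_sum fun i _ => HasDerivAt.fun_sum fun j _ => (h i j).smul_const _
    have e : ∀ M : Matrix (Fin d) (Fin d) ℝ, ∑ i, ∑ j, M i j • Matrix.single i j (1 : ℝ) = M := by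
      intro M
      conv_rhs => rw [Matrix.matrix_eq_sum_single M]
      simp [Matrix.smul_single]
    simpa only [e] using h1
  have hcomm : L t * C t = C t * L t := aux_commute (L t) (C t) (hexp t)
  have hcomm' : L t * (C t)⁻¹ = (C t)⁻¹ * L t := by
    calc L t * (C t)⁻¹ = (C t)⁻¹ * (C t * L t) * (C t)⁻¹ := by
          rw [← Matrix.mul_assoc, Matrix.nonsing_inv_mul _ hinv, Matrix.one_mul]
      _ = (C t)⁻¹ * L t := by
          rw [← hcomm, Matrix.mul_assoc, Matrix.mul_assoc, Matrix.mul_nonsing_inv _ hinv,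
            Matrix.mul_one]
  let T : Matrix (Fin d) (Fin d) ℝ →L[ℝ] ℝ :=
    LinearMap.toContinuousLinearMap (Matrix.traceLinearMap (Fin d) ℝ ℝ)
  have hm := aux_main T (fun x y => Matrix.trace_mul_comm x y) C L C' L' t (key C C' hC) (key L L' hL)
    hexp ((C t)⁻¹ * L t) (by rw [← Matrix.mul_assoc, hcomm'])
  have hm' : (C' * ((C t)⁻¹ * L t)).trace = (C t * L' * ((C t)⁻¹ * L t)).trace := hm
  rw [Matrix.mul_assoc, hm', ← hcomm', Matrix.trace_mul_comm, Matrix.mul_assoc,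
    ← Matrix.mul_assoc (C t)⁻¹, Matrix.nonsing_inv_mul _ hinv, Matrix.one_mul,
    Matrix.trace_mul_comm]

end Mat

/-- derivative of the squared logarithmic strain: if `L(t)` is symmetric,
`C(t)` invertible, `exp (L(t)) = C(t)` (so `L = log C`), with entrywise derivatives `L′`
and `C′`, then `d/dt ‖L(t)‖_F² = 2 tr (C′(t) C(t)⁻¹ L(t))`, where `‖M‖_F² = tr (M Mᵀ)`. -/
theorem deriv_sq_log_strain (d : ℕ) (C L C' L' : ℝ → Matrix (Fin d) (Fin d) ℝ)
    (hC : ∀ t i j, HasDerivAt (fun s => C s i j) (C' t i j) t)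
    (hL : ∀ t i j, HasDerivAt (fun s => L s i j) (L' t i j) t)
    (hsym : ∀ t, (L t)ᵀ = L t)
    (hinv : ∀ t, IsUnit (C t).det)
    (hexp : ∀ t, matExp d (L t) = C t) :
    ∀ t, HasDerivAt (fun s => (L s * (L s)ᵀ).trace)
      (2 * (C' t * (C t)⁻¹ * L t).trace) t := by
  intro t
  rw [aux_mat d C L (C' t) (L' t) t (hC t) (hL t) (hinv t) hexp]
  have h1 : HasDerivAt (fun s => ∑ i, ∑ j, L s i j * L s i j)
      (∑ i, ∑ j, (L' t i j * L t i j + L t i j * L' t i j)) t :=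
    HasDerivAt.fun_sum fun i _ => HasDerivAt.fun_sum fun j _ => (hL t i j).mul (hL t i j)
  convert h1 using 1
  · funext s
    simp only [Matrix.trace, Matrix.diag, Matrix.mul_apply, Matrix.transpose_apply]
  simp only [Matrix.trace, Matrix.diag, Matrix.mul_apply, Matrix.transpose_apply, Finset.mul_sum]
  refine Finset.sum_congr rfl fun i _ => Finset.sum_congr rfl fun j _ => ?_
  have : L t i j = L t j i := congrFun (congrFun (hsym t).symm i) j
  rw [this]
  ring
end

section
/- (Key a priori identity for the transport equation of the left Cauchy–Green tensor.) Let A, C, L : ℝ → Mat_d(ℝ) with C, L differentiable, L(t) symmetric, C(t) invertible, exp(L(t)) = C(t) for every t (so L = log C), and suppose C′(t) = A(t) C(t) + C(t) A(t)ᵀ for all t. Then d/dt ‖L(t)‖_F² = 4 tr( A(t) · L(t) ) for every t, where ‖M‖_F² = tr(M Mᵀ). -/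
open Matrix

section abstractLemma
open NormedSpace Filter Topology

variable {B : Type*} [NormedRing B] [NormedAlgebra ℝ B] [CompleteSpace B]

theorem aux_contDiff : ContDiff ℝ 1 (NormedSpace.exp : B → B) := by
  rw [contDiff_iff_contDiffAt]
  intro x
  exact (NormedSpace.exp_analytic (𝕂 := ℝ) x).contDiffAt

theorem aux_inv (Y : B) : exp (-Y) * exp Y = 1 ∧ exp Y * exp (-Y) = 1 := by
  let _ : NormedAlgebra ℚ B := NormedAlgebra.restrictScalars ℚ ℝ B
  constructor
  · rw [← NormedSpace.exp_add_of_commute ((Commute.refl Y).neg_left), neg_add_cancel, exp_zero]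
  · rw [← NormedSpace.exp_add_of_commute ((Commute.refl Y).neg_right), add_neg_cancel, exp_zero]

theorem aux_half (τ : B →L[ℝ] ℝ) (hτ : ∀ a b, τ (a * b) = τ (b * a)) (N X H : B)
    (hc : Commute N X) :
    τ (N * exp (-X) * fderiv ℝ exp X H) =
      τ (N * exp (-((2⁻¹ : ℝ) • X)) * fderiv ℝ exp ((2⁻¹ : ℝ) • X) H) := by
  let _ : NormedAlgebra ℚ B := NormedAlgebra.restrictScalars ℚ ℝ B
  have hd : Differentiable ℝ (exp : B → B) := aux_contDiff.differentiable one_ne_zero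
  set Y : B := (2⁻¹ : ℝ) • X with hY
  have hXY : X = Y + Y := by rw [hY, ← add_smul]; norm_num
  have hfun : (exp : B → B) = fun x => exp ((2⁻¹ : ℝ) • x) * exp ((2⁻¹ : ℝ) • x) := by
    funext x
    rw [← NormedSpace.exp_add_of_commute (Commute.refl _), ← add_smul]; norm_num
  have h1 : HasFDerivAt (fun x : B => exp ((2⁻¹ : ℝ) • x))
      ((fderiv ℝ exp Y).comp ((2⁻¹ : ℝ) • ContinuousLinearMap.id ℝ B)) X :=
    HasFDerivAt.comp X (hd Y).hasFDerivAt ((hasFDerivAt_id X).const_smul (2⁻¹ : ℝ))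
  have h2 := h1.mul' h1
  change HasFDerivAt (fun x : B => exp ((2⁻¹ : ℝ) • x) * exp ((2⁻¹ : ℝ) • x)) _ X at h2
  rw [← hfun] at h2
  have h3 : fderiv ℝ exp X H =
      (2⁻¹ : ℝ) • (exp Y * fderiv ℝ exp Y H + fderiv ℝ exp Y H * exp Y) := by
    rw [h2.fderiv]
    simp [← hY, smul_add]
  have hcY : Commute N Y := hc.smul_right _
  have hNE : Commute N (exp Y) := hcY.exp_right
  have e1 : exp (-X) = exp (-Y) * exp (-Y) := by
    rw [← NormedSpace.exp_add_of_commute (Commute.refl _), hXY, neg_add]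
  have e2 : exp (-Y) * exp Y = 1 := by
    rw [← NormedSpace.exp_add_of_commute ((Commute.refl Y).neg_left), neg_add_cancel, exp_zero]
  have e3 : exp Y * exp (-Y) = 1 := by
    rw [← NormedSpace.exp_add_of_commute ((Commute.refl Y).neg_right), add_neg_cancel, exp_zero]
  set D := fderiv ℝ exp Y H
  have a1 : N * exp (-X) * (exp Y * D) = N * exp (-Y) * D := by
    rw [e1]
    calc _ = N * exp (-Y) * (exp (-Y) * exp Y) * D := by noncomm_ring
      _ = _ := by rw [e2, mul_one]
  have a2 : τ (N * exp (-X) * (D * exp Y)) = τ (N * exp (-Y) * D) := by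
    rw [← mul_assoc, hτ, ← a1, e1]
    congr 1
    calc _ = (exp Y * N) * exp (-Y) * exp (-Y) * D := by noncomm_ring
      _ = N * (exp Y * exp (-Y)) * exp (-Y) * D := by rw [← hNE.eq]; noncomm_ring
      _ = N * exp (-Y) * (exp (-Y) * exp Y) * D := by rw [e2, e3, mul_one, mul_one]
      _ = _ := by noncomm_ring
  rw [h3, mul_smul_comm, mul_add, map_smul, map_add, a2, a1, smul_eq_mul]
  ring

theorem aux_main_s13 (τ : B →L[ℝ] ℝ) (hτ : ∀ a b, τ (a * b) = τ (b * a)) (N X H : B)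
    (hc : Commute N X) :
    τ (N * exp (-X) * fderiv ℝ exp X H) = τ (N * H) := by
  let _ : NormedAlgebra ℚ B := NormedAlgebra.restrictScalars ℚ ℝ B
  have hit : ∀ n : ℕ, τ (N * exp (-X) * fderiv ℝ exp X H) =
      τ (N * exp (-(((2⁻¹ : ℝ) ^ n) • X)) * fderiv ℝ exp (((2⁻¹ : ℝ) ^ n) • X) H) := by
    intro n
    induction n with
    | zero => simp
    | succ k ih =>
      rw [ih, aux_half τ hτ N _ H (hc.smul_right _), smul_smul, ← pow_succ']
  have hcont : Continuous (fun Y : B => τ (N * exp (-Y) * fderiv ℝ exp Y H)) := by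
    have h1 : Continuous (exp : B → B) := aux_contDiff.continuous
    have h2 : Continuous (fun Y : B => fderiv ℝ (exp : B → B) Y) :=
      aux_contDiff.continuous_fderiv one_ne_zero
    have h3 : Continuous (fun Y : B => fderiv ℝ (exp : B → B) Y H) := h2.clm_apply continuous_const
    exact τ.continuous.comp ((continuous_const.mul (h1.comp continuous_neg)).mul h3)
  have hlim : Tendsto (fun n : ℕ => ((2⁻¹ : ℝ) ^ n) • X) atTop (𝓝 0) := by
    have := (tendsto_pow_atTop_nhds_zero_of_lt_one (r := (2⁻¹ : ℝ)) (by norm_num)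
      (by norm_num)).smul_const X
    simpa using this
  have h := (hcont.tendsto 0).comp hlim
  have h' : Tendsto (fun _ : ℕ => τ (N * exp (-X) * fderiv ℝ exp X H)) atTop
      (𝓝 (τ (N * exp (-(0:B)) * fderiv ℝ exp (0:B) H))) := by
    refine h.congr fun n => ?_
    exact (hit n).symm
  have := tendsto_nhds_unique tendsto_const_nhds h'
  rw [this, (hasFDerivAt_exp_zero (𝕂 := ℝ) (𝔸 := B)).fderiv]
  simp

end abstractLemma

section matrixLemma
attribute [local instance] Matrix.linftyOpNormedRing Matrix.linftyOpNormedAlgebra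
  Matrix.linftyOpNormedAddCommGroup Matrix.linftyOpNormedSpace

theorem aux_hasDerivAt {d : ℕ} {F : ℝ → Matrix (Fin d) (Fin d) ℝ} {F' : Matrix (Fin d) (Fin d) ℝ}
    {t : ℝ} (h : ∀ i j, HasDerivAt (fun s => F s i j) (F' i j) t) : HasDerivAt F F' t := by
  have key : ∀ M : Matrix (Fin d) (Fin d) ℝ, M = ∑ i, ∑ j, M i j • Matrix.single i j (1 : ℝ) := by
    intro M
    conv_lhs => rw [Matrix.matrix_eq_sum_single M]
    simp
  rw [key F', show F = fun s => ∑ i, ∑ j, F s i j • Matrix.single i j (1 : ℝ) from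
    funext fun s => key _]
  exact HasDerivAt.fun_sum fun i _ => HasDerivAt.fun_sum fun j _ => (h i j).smul_const _

theorem aux_trace (d : ℕ)
    (C L : ℝ → Matrix (Fin d) (Fin d) ℝ) (C' L' : Matrix (Fin d) (Fin d) ℝ) (t : ℝ)
    (hC : ∀ i j, HasDerivAt (fun s => C s i j) (C' i j) t)
    (hL : ∀ i j, HasDerivAt (fun s => L s i j) (L' i j) t)
    (hexp : ∀ t, matExp d (L t) = C t) :
    ∃ E : Matrix (Fin d) (Fin d) ℝ, E * C t = 1 ∧ C t * E = 1 ∧ Commute (L t) (C t) ∧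
      (L t * E * C').trace = (L t * L').trace := by
  let _ : NormedAlgebra ℚ (Matrix (Fin d) (Fin d) ℝ) := NormedAlgebra.restrictScalars ℚ ℝ _
  have hexp' : ∀ t, NormedSpace.exp (L t) = C t := by
    intro t
    rw [← hexp t, NormedSpace.exp_eq_tsum ℝ]
    rfl
  have hCm := aux_hasDerivAt hC
  have hLm := aux_hasDerivAt hL
  have hd : DifferentiableAt ℝ NormedSpace.exp (L t) :=
    aux_contDiff.differentiable one_ne_zero _
  have h1 := hd.hasFDerivAt.comp_hasDerivAt t hLm
  have h2 : C = NormedSpace.exp ∘ L := funext fun s => (hexp' s).symm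
  rw [← h2] at h1
  have h3 := hCm.unique h1
  refine ⟨NormedSpace.exp (-(L t)), ?_, ?_, ?_, ?_⟩
  · rw [← hexp' t]
    exact (aux_inv (L t)).1
  · rw [← hexp' t]
    exact (aux_inv (L t)).2
  · rw [← hexp' t]
    exact (Commute.refl (L t)).exp_right
  · rw [h3]
    exact aux_main_s13 (LinearMap.toContinuousLinearMap (Matrix.traceLinearMap (Fin d) ℝ ℝ))
      (fun a b => Matrix.trace_mul_comm a b) (L t) (L t) L' (Commute.refl _)

end matrixLemma

/-- key a priori identity: if `L = log C` (`L` symmetric, `C` invertible,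
`exp L = C`, entrywise derivatives) and `C′ = A C + C Aᵀ`, then
`d/dt ‖L(t)‖_F² = 4 tr (A(t) L(t))`, where `‖M‖_F² = tr (M Mᵀ)`. -/
theorem deriv_sq_log_strain_lyapunov (d : ℕ)
    (A C L L' : ℝ → Matrix (Fin d) (Fin d) ℝ)
    (hC : ∀ t i j, HasDerivAt (fun s => C s i j) ((A t * C t + C t * (A t)ᵀ) i j) t)
    (hL : ∀ t i j, HasDerivAt (fun s => L s i j) (L' t i j) t)
    (hsym : ∀ t, (L t)ᵀ = L t)
    (hinv : ∀ t, IsUnit (C t).det)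
    (hexp : ∀ t, matExp d (L t) = C t) :
    ∀ t, HasDerivAt (fun s => (L s * (L s)ᵀ).trace) (4 * (A t * L t).trace) t := by
  intro t
  obtain ⟨E, hE1, hE2, hcom, htr⟩ :=
    aux_trace d C L (A t * C t + C t * (A t)ᵀ) (L' t) t (hC t) (hL t) hexp
  have hlhs : (L t * E * (A t * C t + C t * (A t)ᵀ)).trace = 2 * (A t * L t).trace := by
    have hEL : L t * E = E * L t := by
      calc L t * E = (E * C t) * L t * E := by rw [hE1, one_mul]
        _ = E * (L t * C t) * E := by rw [hcom.eq]; simp only [Matrix.mul_assoc]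
        _ = E * L t * (C t * E) := by simp only [Matrix.mul_assoc]
        _ = E * L t := by rw [hE2, mul_one]
    have p1 : (L t * E * (A t * C t)).trace = (A t * L t).trace := by
      rw [hEL, ← Matrix.mul_assoc, Matrix.trace_mul_comm]
      have : C t * (E * L t * A t) = (C t * E) * (L t * A t) := by simp only [Matrix.mul_assoc]
      rw [this, hE2, one_mul, Matrix.trace_mul_comm]
    have p2 : (L t * E * (C t * (A t)ᵀ)).trace = (A t * L t).trace := by
      have : L t * E * (C t * (A t)ᵀ) = L t * (E * C t) * (A t)ᵀ := by
        simp only [Matrix.mul_assoc]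
      rw [this, hE1, mul_one, ← Matrix.trace_transpose, Matrix.transpose_mul,
        Matrix.transpose_transpose, hsym]
    rw [Matrix.mul_add, Matrix.trace_add, p1, p2]; ring
  have hfun : (fun s => (L s * (L s)ᵀ).trace) = fun s => ∑ i, ∑ j, L s i j * L s i j := by
    funext s
    simp [Matrix.trace, Matrix.mul_apply]
  have hval : 4 * (A t * L t).trace = ∑ i, ∑ j, (L' t i j * L t i j + L t i j * L' t i j) := by
    have : 4 * (A t * L t).trace = 2 * ((L t)ᵀ * L' t).trace := by
      rw [hsym, ← htr, hlhs]; ring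
    rw [this, Matrix.trace, Finset.mul_sum, Finset.sum_comm]
    refine Finset.sum_congr rfl fun j _ => ?_
    rw [Matrix.diag_apply, Matrix.mul_apply, Finset.mul_sum]
    refine Finset.sum_congr rfl fun i _ => ?_
    rw [Matrix.transpose_apply]; ring
  rw [hfun, hval]
  exact HasDerivAt.fun_sum fun i _ => HasDerivAt.fun_sum fun j _ => (hL t i j).mul (hL t i j)
end

section
/- (A priori identity for the relaxed-strain equation.) Let τ > 0, let Q, Λ : ℝ → Mat_d(ℝ) with Λ(t) symmetric for all t, and let C, L : ℝ → Mat_d(ℝ) be differentiable with L(t) symmetric, C(t) invertible, exp(L(t)) = C(t), and C′(t) = A(t) C(t) + C(t) A(t)ᵀ where A(t) := Q(t) + τ⁻¹ (Λ(t) − L(t)). Then for every t, d/dt ‖L(t)‖_F² = 4 tr( Q(t) L(t) ) + (4/τ) ( tr( Λ(t) L(t) ) − ‖L(t)‖_F² ). -/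
open Matrix

open NormedSpace in
theorem norm_pow_mul_pow_le_aux {A : Type*} [NormedRing A] (a b : A) (p q : ℕ) :
    ‖a ^ p * b * a ^ q‖ ≤ ‖a‖ ^ (p + q) * ‖b‖ := by
  induction q with
  | zero =>
    induction p with
    | zero => simp
    | succ p ih =>
      have h : a ^ (p + 1) * b * a ^ 0 = a * (a ^ p * b * a ^ 0) := by
        simp [pow_succ', mul_assoc]
      rw [h]
      refine (norm_mul_le _ _).trans ?_
      calc ‖a‖ * ‖a ^ p * b * a ^ 0‖ ≤ ‖a‖ * (‖a‖ ^ (p + 0) * ‖b‖) := by gcongr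
        _ = _ := by ring
  | succ q ih =>
    have h : a ^ p * b * a ^ (q + 1) = (a ^ p * b * a ^ q) * a := by
      simp [pow_succ, mul_assoc]
    rw [h]
    refine (norm_mul_le _ _).trans ?_
    calc ‖a ^ p * b * a ^ q‖ * ‖a‖ ≤ (‖a‖ ^ (p + q) * ‖b‖) * ‖a‖ := by gcongr
      _ = _ := by ring

open NormedSpace in
theorem trace_exp_deriv_aux {A : Type*} [NormedRing A] [NormedAlgebra ℝ A] [CompleteSpace A]
    (T : A →L[ℝ] ℝ) (hT : ∀ a b, T (a * b) = T (b * a)) (x H K : A) (hK : Commute K x) :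
    T (K * fderiv ℝ (exp : A → A) x H) = T (K * exp x * H) := by
  set g' : ℕ → ℝ → A := fun k s => ((Nat.factorial k : ℝ))⁻¹ •
    ∑ i ∈ Finset.range k, (x + s • H) ^ (k.pred - i) * H * (x + s • H) ^ i with hg'
  set M : ℝ := ‖x‖ + ‖H‖ with hM
  set u : ℕ → ℝ := fun k => ((Nat.factorial k : ℝ))⁻¹ * (k * (M ^ (k - 1) * ‖H‖)) with hu
  have hfac : ∀ k : ℕ, ((Nat.factorial (k + 1) : ℝ))⁻¹ * ((k + 1 : ℕ) : ℝ)
      = ((Nat.factorial k : ℝ))⁻¹ := by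
    intro k
    rw [Nat.factorial_succ]
    have := Nat.factorial_ne_zero k
    push_cast
    field_simp
  have hus : Summable u := by
    rw [← summable_nat_add_iff 1]
    refine ((Real.summable_pow_div_factorial M).mul_right ‖H‖).congr ?_
    intro k
    simp only [hu, Nat.add_sub_cancel]
    rw [← mul_assoc, hfac]
    ring
  have hbd : ∀ n, ∀ y ∈ Metric.ball (0 : ℝ) 1, ‖g' n y‖ ≤ u n := by
    intro n y hy
    have hy' : |y| < 1 := by simpa using hy
    have hyM : ‖x + y • H‖ ≤ M := by
      refine (norm_add_le _ _).trans ?_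
      rw [norm_smul, Real.norm_eq_abs, hM]
      have := mul_le_mul_of_nonneg_right hy'.le (norm_nonneg H)
      linarith
    simp only [hg', hu]
    rw [norm_smul, norm_inv, Real.norm_natCast]
    gcongr
    refine (norm_sum_le _ _).trans ?_
    refine (Finset.sum_le_card_nsmul _ _ (M ^ (n - 1) * ‖H‖) ?_).trans ?_
    · intro i hi
      have hi' := Finset.mem_range.1 hi
      refine (norm_pow_mul_pow_le_aux _ _ _ _).trans ?_
      have : n.pred - i + i = n - 1 := by simp only [Nat.pred_eq_sub_one]; omega
      rw [this]
      gcongr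
    · simp
  have hd : ∀ n, ∀ y ∈ Metric.ball (0 : ℝ) 1, HasDerivAt
      (fun s : ℝ => ((Nat.factorial n : ℝ))⁻¹ • (x + s • H) ^ n) (g' n y) y := by
    intro n y _
    have h1 : HasDerivAt (fun s : ℝ => x + s • H) H y := by
      simpa using ((hasDerivAt_id y).smul_const H).const_add x
    have h2 := (h1.hasFDerivAt.fun_pow' n).hasDerivAt.const_smul ((Nat.factorial n : ℝ))⁻¹
    refine h2.congr_deriv ?_
    simp [g', mul_assoc]
  have h0 : (0 : ℝ) ∈ Metric.ball (0 : ℝ) 1 := by simp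
  have hsum := hasDerivAt_tsum_of_isPreconnected hus Metric.isOpen_ball
    (convex_ball (0 : ℝ) 1).isPreconnected hd hbd h0
    (by exact expSeries_summable' (𝕂 := ℝ) (x + (0 : ℝ) • H)) h0
  have hline : HasDerivAt (fun s : ℝ => exp (x + s • H)) (fderiv ℝ (exp : A → A) x H) 0 := by
    have h1 : HasDerivAt (fun s : ℝ => x + s • H) H 0 := by
      simpa using ((hasDerivAt_id (0 : ℝ)).smul_const H).const_add x
    have h2 : HasFDerivAt (exp : A → A) (fderiv ℝ (exp : A → A) x) (x + (0 : ℝ) • H) := by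
      simpa using (exp_analytic (𝕂 := ℝ) x).differentiableAt.hasFDerivAt
    exact h2.comp_hasDerivAt _ h1
  have heq : fderiv ℝ (exp : A → A) x H = ∑' n, g' n 0 := by
    refine hline.unique ?_
    simpa [exp_eq_tsum ℝ] using hsum
  have hgs : Summable (fun n => g' n 0) := .of_norm_bounded hus fun n => hbd n 0 h0
  let S : A →L[ℝ] ℝ := T.comp (ContinuousLinearMap.mul ℝ A K)
  let R : A →L[ℝ] ℝ := S.comp ((ContinuousLinearMap.mul ℝ A).flip H)
  have hA : HasSum (fun n => S (g' n 0)) (S (fderiv ℝ (exp : A → A) x H)) := by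
    rw [heq]; exact S.hasSum hgs.hasSum
  have hB : HasSum (fun n => R (((Nat.factorial n : ℝ))⁻¹ • x ^ n)) (R (exp x)) :=
    R.hasSum (exp_series_hasSum_exp' (𝕂 := ℝ) x)
  have hA' : HasSum (fun n => S (g' (n + 1) 0)) (S (fderiv ℝ (exp : A → A) x H)) := by
    have := (hasSum_nat_add_iff' 1).2 hA
    simpa [hg'] using this
  have hterm : (fun n => S (g' (n + 1) 0)) = fun n => R (((Nat.factorial n : ℝ))⁻¹ • x ^ n) := by
    funext n
    simp only [hg', zero_smul, add_zero, map_smul, map_sum]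
    rw [Finset.sum_congr rfl (g := fun _ => R (x ^ n))]
    · rw [Finset.sum_const, Finset.card_range, ← hfac n]
      simp [mul_assoc]
    · intro i hi
      have hi' := Finset.mem_range.1 hi
      change T (K * (x ^ (n - i) * H * x ^ i)) = T (K * (x ^ n * H))
      rw [← mul_assoc, hT, ← mul_assoc, ← mul_assoc, ← (hK.pow_right i).eq, mul_assoc K,
        ← pow_add, mul_assoc]
      congr 4
      omega
  rw [hterm] at hA'
  have := hA'.unique hB
  simpa [S, R, mul_assoc] using this

theorem trace_exp_curve_aux {A : Type*} [NormedRing A] [NormedAlgebra ℝ A] [CompleteSpace A]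
    (T : A →L[ℝ] ℝ) (hT : ∀ a b, T (a * b) = T (b * a)) (c l : ℝ → A) (t : ℝ) (X Y K : A)
    (hE : ∀ s, NormedSpace.exp (l s) = c s) (hl : HasDerivAt l X t) (hc : HasDerivAt c Y t)
    (hK : Commute K (l t)) :
    T (K * Y) = T (K * c t * X) := by
  have hY : Y = fderiv ℝ (NormedSpace.exp : A → A) (l t) X := by
    refine hc.unique ?_
    have h := (NormedSpace.exp_analytic (𝕂 := ℝ) (l t)).differentiableAt.hasFDerivAt.comp_hasDerivAt
      t hl
    have h3 : (NormedSpace.exp ∘ l) = c := funext hE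
    rwa [h3] at h
  rw [hY, ← hE t]
  exact trace_exp_deriv_aux T hT _ _ _ hK

section MainProof
attribute [local instance] Matrix.linftyOpNormedRing Matrix.linftyOpNormedAlgebra

theorem key_matrix_aux (d : ℕ) (C L : ℝ → Matrix (Fin d) (Fin d) ℝ)
    (X Y : Matrix (Fin d) (Fin d) ℝ) (t : ℝ)
    (hinv : IsUnit (C t).det)
    (hexp : ∀ t, matExp d (L t) = C t)
    (hL : ∀ i j, HasDerivAt (fun s => L s i j) (X i j) t)
    (hC : ∀ i j, HasDerivAt (fun s => C s i j) (Y i j) t) :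
    Commute (L t) (C t) ∧ (L t * X).trace = (L t * (C t)⁻¹ * Y).trace := by
  have hE : ∀ s, NormedSpace.exp (L s) = C s := by
    intro s
    rw [← hexp s, NormedSpace.exp_eq_tsum ℝ]
    rfl
  have hmat : ∀ (F : ℝ → Matrix (Fin d) (Fin d) ℝ) (F' : Matrix (Fin d) (Fin d) ℝ),
      (∀ i j, HasDerivAt (fun s => F s i j) (F' i j) t) → HasDerivAt F F' t := by
    intro F F' h
    have h1 : HasDerivAt (fun s => ∑ i, ∑ j, F s i j • Matrix.single i j (1 : ℝ))
        (∑ i, ∑ j, F' i j • Matrix.single i j (1 : ℝ)) t := by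
      refine HasDerivAt.fun_sum fun i _ => HasDerivAt.fun_sum fun j _ => ?_
      exact (h i j).smul_const _
    have h2 : ∀ N : Matrix (Fin d) (Fin d) ℝ,
        ∑ i, ∑ j, N i j • Matrix.single i j (1 : ℝ) = N := by
      intro N
      conv_rhs => rw [Matrix.matrix_eq_sum_single N]
      simp [Matrix.smul_single]
    simpa only [h2] using h1
  have hL' := hmat L X hL
  have hC' := hmat C Y hC
  have hcomm : Commute (L t) (C t) := by
    rw [← hE t]
    exact (Commute.refl (L t)).exp_right
  have hcomm' : Commute (L t) (C t)⁻¹ := by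
    have h1 := Matrix.mul_nonsing_inv (C t) hinv
    have h2 := Matrix.nonsing_inv_mul (C t) hinv
    calc L t * (C t)⁻¹ = (C t)⁻¹ * C t * (L t * (C t)⁻¹) := by rw [h2, one_mul]
      _ = (C t)⁻¹ * (C t * L t) * (C t)⁻¹ := by simp only [mul_assoc]
      _ = (C t)⁻¹ * (L t * C t) * (C t)⁻¹ := by rw [hcomm.eq]
      _ = (C t)⁻¹ * L t * (C t * (C t)⁻¹) := by simp only [mul_assoc]
      _ = _ := by rw [h1, mul_one]
  refine ⟨hcomm, ?_⟩
  have hk := trace_exp_curve_aux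
    (LinearMap.toContinuousLinearMap (Matrix.traceLinearMap (Fin d) ℝ ℝ))
    (fun a b => by simpa using Matrix.trace_mul_comm a b) C L t X Y (L t * (C t)⁻¹)
    hE hL' hC' ((Commute.refl _).mul_left hcomm'.symm)
  rw [mul_assoc (L t) _ (C t), Matrix.nonsing_inv_mul (C t) hinv, mul_one] at hk
  simpa using hk.symm
end MainProof

/-- a priori identity for the relaxed-strain equation: with `τ > 0`,
`Λ(t)` symmetric, `L = log C` (`L` symmetric, `C` invertible, `exp L = C`, entrywise
derivatives), and `C′ = A C + C Aᵀ` for `A = Q + τ⁻¹ (Λ − L)`, one has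
`d/dt ‖L(t)‖_F² = 4 tr (Q(t) L(t)) + (4/τ) (tr (Λ(t) L(t)) − ‖L(t)‖_F²)`. -/
theorem deriv_sq_relaxed_log_strain (d : ℕ) (τ : ℝ) (hτ : 0 < τ)
    (Q Λ C L L' : ℝ → Matrix (Fin d) (Fin d) ℝ)
    (hΛ : ∀ t, (Λ t)ᵀ = Λ t)
    (hsym : ∀ t, (L t)ᵀ = L t)
    (hinv : ∀ t, IsUnit (C t).det)
    (hexp : ∀ t, matExp d (L t) = C t)
    (hL : ∀ t i j, HasDerivAt (fun s => L s i j) (L' t i j) t)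
    (hC : ∀ t i j, HasDerivAt (fun s => C s i j)
        (((Q t + τ⁻¹ • (Λ t - L t)) * C t + C t * (Q t + τ⁻¹ • (Λ t - L t))ᵀ) i j) t) :
    ∀ t, HasDerivAt (fun s => (L s * (L s)ᵀ).trace)
      (4 * (Q t * L t).trace + (4 / τ) * ((Λ t * L t).trace - (L t * (L t)ᵀ).trace)) t := by
  intro t
  obtain ⟨hcomm, hkey⟩ := key_matrix_aux d C L (L' t) _ t (hinv t) hexp (hL t) (hC t)
  have h1 := Matrix.mul_nonsing_inv (C t) (hinv t)
  have h2 := Matrix.nonsing_inv_mul (C t) (hinv t)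
  have hder : HasDerivAt (fun s => (L s * (L s)ᵀ).trace) (2 * (L t * L' t).trace) t := by
    have e1 : (fun s => (L s * (L s)ᵀ).trace) = fun s => ∑ i, ∑ j, L s i j * L s i j := by
      funext s
      simp [Matrix.trace, Matrix.mul_apply]
    rw [e1]
    have h3 : HasDerivAt (fun s => ∑ i, ∑ j, L s i j * L s i j)
        (∑ i, ∑ j, (L' t i j * L t i j + L t i j * L' t i j)) t :=
      HasDerivAt.fun_sum fun i _ => HasDerivAt.fun_sum fun j _ => (hL t i j).mul (hL t i j)
    refine h3.congr_deriv ?_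
    have e2 : (L t * L' t).trace = ((L t)ᵀ * L' t).trace := by rw [hsym]
    rw [e2]
    simp only [Matrix.trace, Matrix.diag_apply, Matrix.mul_apply, Matrix.transpose_apply]
    rw [Finset.sum_comm, Finset.mul_sum]
    refine Finset.sum_congr rfl fun i _ => ?_
    rw [Finset.mul_sum]
    exact Finset.sum_congr rfl fun j _ => by ring
  refine hder.congr_deriv ?_
  rw [hkey]
  set A := Q t + τ⁻¹ • (Λ t - L t) with hA
  have e3 : (L t * (C t)⁻¹ * (A * C t)).trace = (A * L t).trace := by
    rw [Matrix.trace_mul_comm]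
    have : A * C t * (L t * (C t)⁻¹) = A * L t := by
      rw [mul_assoc, ← mul_assoc (C t), ← hcomm.eq, mul_assoc, h1, mul_one]
    rw [this]
  have e4 : (L t * (C t)⁻¹ * (C t * Aᵀ)).trace = (A * L t).trace := by
    have : L t * (C t)⁻¹ * (C t * Aᵀ) = L t * Aᵀ := by
      rw [mul_assoc, ← mul_assoc (C t)⁻¹, h2, one_mul]
    rw [this, ← Matrix.trace_transpose, Matrix.transpose_mul, Matrix.transpose_transpose, hsym]
  rw [mul_add, Matrix.trace_add, e3, e4, hA, hsym]
  simp only [add_mul, sub_mul, Matrix.smul_mul, Matrix.trace_add, Matrix.trace_smul,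
    Matrix.trace_sub, smul_eq_mul]
  field_simp
  ring
end

section
/- (Leray–Schauder alternative.) Let X be a real Banach space and let A : X → X be a compact (completely continuous) operator, i.e. A is continuous and maps bounded subsets of X to relatively compact subsets of X. If the set S = { u ∈ X : A u = λ u for some λ > 1 } is bounded, then the equation A u = u has a solution; equivalently, either A has a fixed point or S is unbounded. -/
open MeasureTheory Metric Set in
theorem ls_lagrange (d : ℕ) (t : ℕ → ℝ) (ht : Function.Injective t) :
    ∃ c : ℕ → ℝ, (∑ i ∈ Finset.range (d+1), c i = 1) ∧
      ∀ p : Polynomial ℝ, p.natDegree ≤ d →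
        p.eval 1 = ∑ i ∈ Finset.range (d+1), c i * p.eval (t i) := by
  refine ⟨fun i => (Lagrange.basis (Finset.range (d+1)) t i).eval 1, ?_, ?_⟩
  · rw [← Polynomial.eval_finsetSum, Lagrange.sum_basis ht.injOn (by simp)]
    simp
  · intro p hp
    have hd : p.degree < (Finset.range (d+1)).card := by
      rw [Finset.card_range]
      exact lt_of_le_of_lt Polynomial.degree_le_natDegree (by exact_mod_cast Nat.lt_succ_of_le hp)
    have h := Lagrange.eq_interpolate (v := t) (s := Finset.range (d+1)) ht.injOn hd
    conv_lhs => rw [h]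
    rw [Lagrange.interpolate_apply, Polynomial.eval_finsetSum]
    refine Finset.sum_congr rfl fun i _ => ?_
    rw [Polynomial.eval_mul, Polynomial.eval_C, mul_comm]

theorem ls_det_poly {E : Type*} [NormedAddCommGroup E] [NormedSpace ℝ E] [FiniteDimensional ℝ E]
    (M : E →L[ℝ] E) :
    ∃ p : Polynomial ℝ, p.natDegree ≤ Module.finrank ℝ E ∧
      ∀ t : ℝ, p.eval t = (ContinuousLinearMap.id ℝ E + t • M).det := by
  classical
  let b := Module.finBasis ℝ E
  let A := LinearMap.toMatrix b b (M : E →ₗ[ℝ] E)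
  refine ⟨Matrix.det ((Polynomial.X : Polynomial ℝ) • A.map Polynomial.C
    + (1 : Matrix _ _ ℝ).map Polynomial.C), ?_, ?_⟩
  · simpa using Polynomial.natDegree_det_X_add_C_le A 1
  · intro t
    rw [← Polynomial.coe_evalRingHom, RingHom.map_det, ContinuousLinearMap.det,
      ← LinearMap.det_toMatrix b]
    congr 1
    ext i j
    have h1 : ((1 : Matrix (Fin (Module.finrank ℝ E)) (Fin (Module.finrank ℝ E)) ℝ)) =
      LinearMap.toMatrix b b LinearMap.id := (LinearMap.toMatrix_id b).symm
    simp only [ContinuousLinearMap.toLinearMap_add, ContinuousLinearMap.toLinearMap_smul,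
      ContinuousLinearMap.coe_id, map_add, map_smul, h1, A]
    simp
    ring

theorem ls_det_pos {E : Type*} [NormedAddCommGroup E] [NormedSpace ℝ E] [FiniteDimensional ℝ E]
    (M : E →L[ℝ] E) (hM : ‖M‖ < 1) : 0 < (ContinuousLinearMap.id ℝ E + M).det := by
  have hne : ∀ s ∈ Set.Icc (0:ℝ) 1, (ContinuousLinearMap.id ℝ E + s • M).det ≠ 0 := by
    intro s hs h0
    have := LinearMap.bot_lt_ker_of_det_eq_zero h0
    obtain ⟨v, hv, hv0⟩ := (Submodule.ne_bot_iff _).1 this.ne'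
    have h1 : v + s • M v = 0 := by simpa using hv
    have h2 : ‖v‖ = ‖s • M v‖ := by
      have := congrArg norm (eq_neg_of_add_eq_zero_left h1)
      rwa [norm_neg] at this
    have h3 : ‖s • M v‖ ≤ ‖M‖ * ‖v‖ := by
      rw [norm_smul, Real.norm_eq_abs, abs_of_nonneg hs.1]
      calc s * ‖M v‖ ≤ 1 * ‖M v‖ := by gcongr; exact hs.2
        _ ≤ _ := by rw [one_mul]; exact M.le_opNorm v
    have : 0 < ‖v‖ := norm_pos_iff.2 hv0
    nlinarith
  have hc : ContinuousOn (fun s : ℝ => (ContinuousLinearMap.id ℝ E + s • M).det) (Set.Icc 0 1) :=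
    (ContinuousLinearMap.continuous_det.comp (by fun_prop)).continuousOn
  by_contra hle
  push Not at hle
  have h0 : (fun s : ℝ => (ContinuousLinearMap.id ℝ E + s • M).det) 0 = 1 := by
    simp only [zero_smul, add_zero]
    exact LinearMap.det_id
  have := intermediate_value_Icc' (zero_le_one) hc
  have h4 : (0:ℝ) ∈ Set.Icc ((fun s : ℝ => (ContinuousLinearMap.id ℝ E + s • M).det) 1) ((fun s : ℝ => (ContinuousLinearMap.id ℝ E + s • M).det) 0) := by
    rw [h0]; simpa using hle
  obtain ⟨s, hs, hs0⟩ := this h4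
  exact hne s hs hs0

/-- perturbation of the identity supported in the unit ball -/
theorem ls_lip {E : Type*} [NormedAddCommGroup E] [NormedSpace ℝ E]
    (u : E → E) (L : ℝ) (hL : 0 ≤ L)
    (hu : ∀ x ∈ Metric.closedBall (0:E) 1, ∀ y ∈ Metric.closedBall (0:E) 1, ‖u x - u y‖ ≤ L * ‖x - y‖)
    (hs : ∀ x, ‖x‖ = 1 → u x = 0) (x y : E) :
    ‖(Metric.closedBall (0:E) 1).indicator u x - (Metric.closedBall (0:E) 1).indicator u y‖
      ≤ L * ‖x - y‖ := by
  have key : ∀ x y : E, ‖x‖ ≤ 1 → 1 < ‖y‖ → ‖u x‖ ≤ L * ‖x - y‖ := by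
    intro x y hx hy
    have hc : ContinuousOn (fun s : ℝ => ‖x + s • (y - x)‖) (Set.Icc 0 1) := by fun_prop
    have := intermediate_value_Icc (zero_le_one) hc
    obtain ⟨s, hs1, hs2⟩ := this (show (1:ℝ) ∈ _ by simp [hx, hy.le])
    have h1 := hu x (by simpa using hx) (x + s • (y - x)) (by simpa using hs2.le)
    rw [hs _ hs2, sub_zero] at h1
    refine h1.trans ?_
    gcongr
    rw [sub_add_cancel_left, norm_neg, norm_smul, Real.norm_eq_abs, abs_of_nonneg hs1.1, norm_sub_rev y x]
    exact mul_le_of_le_one_left (norm_nonneg _) hs1.2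
  by_cases hx : ‖x‖ ≤ 1 <;> by_cases hy : ‖y‖ ≤ 1
  · simpa [Set.indicator, hx, hy] using hu x (by simpa using hx) y (by simpa using hy)
  · simpa [Set.indicator, hx, hy] using key x y hx (not_le.1 hy)
  · simpa [Set.indicator, hx, hy, norm_sub_rev] using key y x hy (not_le.1 hx)
  · simp [Set.indicator, hx, hy]; positivity

theorem ls_bij {E : Type*} [NormedAddCommGroup E] [NormedSpace ℝ E] [CompleteSpace E]
    (w : E → E) (c : ℝ) (hc0 : 0 ≤ c) (hc : c < 1) (hw : ∀ x y, ‖w x - w y‖ ≤ c * ‖x - y‖) :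
    Function.Bijective (fun x => x + w x) := by
  have hf : ApproximatesLinearOn (fun x => x + w x)
      ((ContinuousLinearEquiv.refl ℝ E : E ≃L[ℝ] E) : E →L[ℝ] E) Set.univ ⟨c, hc0⟩ := by
    intro x _ y _
    have := hw x y
    simp only [ContinuousLinearEquiv.coe_refl, ContinuousLinearMap.id_apply]
    rw [show x + w x - (y + w y) - (x - y) = w x - w y by abel]
    exact this
  have hN : Subsingleton E ∨ (⟨c, hc0⟩ : NNReal) <
      ‖((ContinuousLinearEquiv.refl ℝ E).symm : E →L[ℝ] E)‖₊⁻¹ := by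
    rcases subsingleton_or_nontrivial E with h | h
    · exact Or.inl h
    · right
      have : ‖((ContinuousLinearEquiv.refl ℝ E).symm : E →L[ℝ] E)‖₊ = 1 := by
        simp
      rw [this, inv_one]
      exact hc
  exact ⟨fun x y h => hf.injOn hN (Set.mem_univ x) (Set.mem_univ y) h, hf.surjective hN⟩

open MeasureTheory in
theorem ls_volume {E : Type*} [NormedAddCommGroup E] [NormedSpace ℝ E]
    [FiniteDimensional ℝ E] [MeasurableSpace E] [BorelSpace E] (μ : Measure E) [μ.IsAddHaarMeasure]
    (r : E → E) (hr : ∀ x ∈ Metric.closedBall (0:E) 1, ContDiffAt ℝ 1 r x)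
    (hs : ∀ x, ‖x‖ = 1 → r x = x) :
    ∃ x ∈ Metric.ball (0:E) 1, (fderiv ℝ r x).det ≠ 0 := by
  set B := Metric.ball (0:E) 1 with hB
  set K := Metric.closedBall (0:E) 1 with hK
  have hBK : B ⊆ K := Metric.ball_subset_closedBall
  let D : E → (E →L[ℝ] E) := fun x => fderiv ℝ r x - ContinuousLinearMap.id ℝ E
  let u : E → E := fun x => r x - x
  have hKc : IsCompact K := isCompact_closedBall _ _
  have hDc : ContinuousOn D K := by
    intro x hx
    exact (((hr x hx).fderiv_right (m := 0) (by norm_num)).continuousAt.sub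
      continuousAt_const).continuousWithinAt
  have hD : ∀ x ∈ K, HasFDerivAt u (D x) x := fun x hx =>
    ((hr x hx).differentiableAt (by norm_num)).hasFDerivAt.sub (hasFDerivAt_id x)
  obtain ⟨L, hL⟩ := hKc.exists_bound_of_continuousOn hDc
  have hL0 : 0 ≤ L := (norm_nonneg _).trans (hL 0 (by simp [hK]))
  have hu : ∀ x ∈ K, ∀ y ∈ K, ‖u x - u y‖ ≤ L * ‖x - y‖ := by
    intro x hx y hy
    exact (convex_closedBall (0:E) 1).norm_image_sub_le_of_norm_hasFDerivWithin_le
      (fun z hz => (hD z hz).hasFDerivWithinAt) hL hy hx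
  have hus : ∀ x, ‖x‖ = 1 → u x = 0 := fun x hx => by simp [u, hs x hx]
  let w := K.indicator u
  have hw := ls_lip u L hL0 hu hus
  let F : ℝ → E → ℝ := fun t x => (ContinuousLinearMap.id ℝ E + t • D x).det
  have hFint : ∀ t, IntegrableOn (F t) B μ := by
    intro t
    refine (ContinuousOn.integrableOn_compact hKc ?_).mono_set hBK
    exact ContinuousLinearMap.continuous_det.comp_continuousOn
      (continuousOn_const.add (hDc.const_smul t))
  have hsmall : ∀ t, 0 ≤ t → t * L < 1 → ∫ x in B, F t x ∂μ = μ.real B := by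
    intro t ht htL
    have hbij : Function.Bijective (fun x => x + t • w x) := by
      refine ls_bij (fun x => t • w x) (t * L) (by positivity) htL fun x y => ?_
      rw [← smul_sub, norm_smul, Real.norm_eq_abs, abs_of_nonneg ht, mul_assoc]
      gcongr
      exact hw x y
    have hout : ∀ x, x ∉ B → x + t • w x = x := by
      intro x hx
      have : w x = 0 := by
        by_cases hxK : x ∈ K
        · have : ‖x‖ = 1 := le_antisymm (by simpa [hK] using hxK) (by simpa [hB] using hx)
          simp [w, hxK, hus x this]
        · simp [w, hxK]
      simp [this]
    have himg : (fun x => x + t • w x) '' B = B := by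
      have h1 : (fun x => x + t • w x) '' Bᶜ = Bᶜ := by
        rw [Set.image_congr (s := Bᶜ) (g := id) (fun x hx => hout x hx), Set.image_id]
      have h2 := Set.image_compl_eq hbij (s := B)
      rw [h1] at h2
      exact (compl_injective h2).symm
    have hder : ∀ x ∈ B, HasFDerivWithinAt (fun x => x + t • w x)
        (ContinuousLinearMap.id ℝ E + t • D x) B x := by
      intro x hx
      have h1 : HasFDerivAt (fun x => x + t • u x) (ContinuousLinearMap.id ℝ E + t • D x) x :=
        (hasFDerivAt_id x).add ((hD x (hBK hx)).const_smul t)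
      refine h1.hasFDerivWithinAt.congr (fun y hy => ?_) ?_
      · simp [w, hBK hy]
      · simp [w, hBK hx]
    have h3 := integral_image_eq_integral_abs_det_fderiv_smul μ
      (Metric.isOpen_ball.measurableSet) hder hbij.injective.injOn (fun _ => (1:ℝ))
    rw [himg] at h3
    rw [setIntegral_const] at h3
    rw [← mul_one (μ.real B), ← smul_eq_mul, h3]
    refine setIntegral_congr_fun Metric.isOpen_ball.measurableSet fun x hx => ?_
    have hpos : 0 < F t x := by
      apply ls_det_pos
      rw [norm_smul, Real.norm_eq_abs, abs_of_nonneg ht]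
      exact lt_of_le_of_lt (by gcongr; exact hL x (hBK hx)) htL
    simp only [smul_eq_mul, mul_one]
    exact (abs_of_pos hpos).symm
  let τ : ℕ → ℝ := fun i => 1 / ((L + 1) * (i + 1))
  have hτ : Function.Injective τ := by
    intro i j hij
    have h1 : (L + 1) * ((i:ℝ) + 1) = (L + 1) * (j + 1) := by
      simpa [τ] using hij
    have h2 := mul_left_cancel₀ (by positivity) h1
    exact_mod_cast add_right_cancel h2
  have hτ2 : ∀ i, 0 ≤ τ i ∧ τ i * L < 1 := by
    intro i
    refine ⟨by positivity, ?_⟩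
    have : (0:ℝ) ≤ i := by positivity
    simp only [τ]
    rw [div_mul_eq_mul_div, div_lt_one (by positivity)]
    nlinarith
  obtain ⟨c, hc1, hc⟩ := ls_lagrange (Module.finrank ℝ E) τ hτ
  have hF1 : ∀ x, F 1 x = ∑ i ∈ Finset.range (Module.finrank ℝ E + 1), c i * F (τ i) x := by
    intro x
    obtain ⟨p, hp, hpe⟩ := ls_det_poly (D x)
    have := hc p hp
    simpa only [hpe] using this
  have hI : ∫ x in B, F 1 x ∂μ = μ.real B := by
    simp_rw [hF1]
    rw [integral_finsetSum _ (fun i _ => (hFint _).const_mul _)]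
    simp_rw [integral_const_mul, hsmall _ (hτ2 _).1 (hτ2 _).2]
    rw [← Finset.sum_mul, hc1, one_mul]
  by_contra! hcon
  have h0 : ∫ x in B, F 1 x ∂μ = 0 := by
    rw [setIntegral_congr_fun (g := fun _ => (0:ℝ)) Metric.isOpen_ball.measurableSet]
    · simp
    · intro x hx
      have : ContinuousLinearMap.id ℝ E + (1:ℝ) • D x = fderiv ℝ r x := by simp [D]
      simp only [F]
      rw [this]
      exact hcon x hx
  rw [h0] at hI
  have : 0 < μ.real B := by
    rw [measureReal_def]
    exact ENNReal.toReal_pos (Metric.measure_ball_pos μ _ one_pos).ne' measure_ball_lt_top.ne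
  linarith

theorem ls_brouwer_smooth {E : Type*} [NormedAddCommGroup E] [InnerProductSpace ℝ E]
    [FiniteDimensional ℝ E] (p : E → E) (hp : ContDiff ℝ 1 p)
    (hp1 : ∀ x ∈ Metric.closedBall (0:E) 1, ‖p x‖ < 1) :
    ∃ x ∈ Metric.closedBall (0:E) 1, p x = x := by
  by_contra! hne
  borelize E
  let v : E → E := fun x => x - p x
  let a : E → ℝ := fun x => inner ℝ (v x) (v x)
  let b : E → ℝ := fun x => inner ℝ x (v x)
  let d : E → ℝ := fun x => b x ^ 2 + a x * (1 - inner ℝ x x)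
  let r : E → E := fun x => x + ((-b x + √(d x)) / a x) • v x
  have hv : ContDiff ℝ 1 v := contDiff_id.sub hp
  have ha : ContDiff ℝ 1 a := hv.inner ℝ hv
  have hb : ContDiff ℝ 1 b := contDiff_id.inner ℝ hv
  have hd : ContDiff ℝ 1 d := (hb.pow 2).add (ha.mul (contDiff_const.sub (contDiff_id.inner ℝ contDiff_id)))
  have hapos : ∀ x ∈ Metric.closedBall (0:E) 1, 0 < a x := by
    intro x hx
    have : v x ≠ 0 := fun h => hne x hx (sub_eq_zero.1 h).symm
    exact real_inner_self_pos.2 this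
  have hbpos : ∀ x : E, ‖x‖ = 1 → 0 < b x := by
    intro x hx
    have h1 := hp1 x (by simp [hx])
    have h2 := real_inner_le_norm x (p x)
    simp only [b, v, inner_sub_right, real_inner_self_eq_norm_sq]
    rw [hx] at h2 ⊢
    linarith
  have hdpos : ∀ x ∈ Metric.closedBall (0:E) 1, 0 < d x := by
    intro x hx
    have h1 : ‖x‖ ≤ 1 := by simpa using hx
    have h2 := hapos x hx
    simp only [d, real_inner_self_eq_norm_sq]
    rcases h1.lt_or_eq with h | h
    · have : 0 < 1 - ‖x‖^2 := by nlinarith [norm_nonneg x]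
      positivity
    · have := hbpos x h
      rw [h]
      nlinarith
  have hrn : ∀ x ∈ Metric.closedBall (0:E) 1, inner ℝ (r x) (r x) = (1:ℝ) := by
    intro x hx
    have h1 := hapos x hx
    have h2 := Real.sq_sqrt (hdpos x hx).le
    simp only [r, inner_add_left, inner_add_right, real_inner_smul_left, real_inner_smul_right]
    rw [real_inner_comm x (v x)]
    change inner ℝ x x + _ * b x + (_ * b x + _ * (_ * a x)) = 1
    rw [real_inner_comm] at *
    have h3 : √(d x) ^ 2 = b x ^ 2 + a x * (1 - inner ℝ x x) := h2
    field_simp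
    nlinarith
  have hrs : ∀ x, ‖x‖ = 1 → r x = x := by
    intro x hx
    have h1 : d x = b x ^ 2 := by simp [d, hx]
    simp [r, h1, Real.sqrt_sq (hbpos x hx).le]
  have hrc : ∀ x ∈ Metric.closedBall (0:E) 1, ContDiffAt ℝ 1 r x := by
    intro x hx
    exact contDiffAt_id.add (((hb.contDiffAt.neg.add (hd.contDiffAt.sqrt (hdpos x hx).ne')).div
      ha.contDiffAt (hapos x hx).ne').smul hv.contDiffAt)
  obtain ⟨x, hx, hdet⟩ := ls_volume MeasureTheory.Measure.addHaar r hrc hrs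
  have hxK := Metric.ball_subset_closedBall hx
  have hder := ((hrc x hxK).differentiableAt (by norm_num)).hasFDerivAt
  have h1 := hder.inner ℝ hder
  have h2 : (fun y => inner ℝ (r y) (r y)) =ᶠ[nhds x] fun _ => (1:ℝ) := by
    filter_upwards [Metric.isOpen_ball.mem_nhds hx] with y hy
    exact hrn y (Metric.ball_subset_closedBall hy)
  have h3 := h1.unique ((hasFDerivAt_const (1:ℝ) x).congr_of_eventuallyEq h2)
  let e := (fderiv ℝ r x).toContinuousLinearEquivOfDetNeZero hdet
  have h4 := congrArg (fun T => T (e.symm (r x))) h3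
  have h5 : fderiv ℝ r x (e.symm (r x)) = r x := e.apply_symm_apply (r x)
  have h6 := hrn x hxK
  simp [h5] at h4
  rw [h4] at h6
  simp at h6

theorem ls_brouwer {E : Type*} [NormedAddCommGroup E] [InnerProductSpace ℝ E]
    [FiniteDimensional ℝ E] (g : E → E) (hg : Continuous g) (hg1 : ∀ x, ‖g x‖ ≤ 1 / 2) :
    ∃ x, g x = x := by
  by_contra! hne
  have hKc : IsCompact (Metric.closedBall (0:E) 1) := isCompact_closedBall _ _
  obtain ⟨x0, hx0, hmin⟩ := hKc.exists_isMinOn ⟨0, by simp⟩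
    (f := fun x => ‖g x - x‖) (by fun_prop)
  have hpos : 0 < ‖g x0 - x0‖ := norm_pos_iff.2 (sub_ne_zero.2 (hne x0))
  obtain ⟨p, hp, hpg, -⟩ := hg.exists_contDiff_approx 1
    (ε := fun _ => min ‖g x0 - x0‖ (1/2)) continuous_const (fun _ => by positivity)
  obtain ⟨x, hx, hfix⟩ := ls_brouwer_smooth p (by exact_mod_cast hp) (by
    intro x _
    have h1 := (hpg x).trans_le (min_le_right _ _)
    rw [dist_eq_norm] at h1
    have := norm_le_norm_add_norm_sub' (p x) (g x)
    linarith [hg1 x])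
  have h1 := (hpg x).trans_le (min_le_left _ _)
  have h2 : ‖g x0 - x0‖ ≤ ‖g x - x‖ := hmin hx
  rw [hfix, dist_eq_norm, norm_sub_rev] at h1
  linarith

theorem ls_brouwer' {F : Type*} [NormedAddCommGroup F] [NormedSpace ℝ F]
    [FiniteDimensional ℝ F] (g : F → F) (hg : Continuous g) (M : ℝ) (hgM : ∀ x, ‖g x‖ ≤ M) :
    ∃ x, g x = x := by
  let e := toEuclidean (E := F)
  let N : ℝ := 2 * (‖(e : F →L[ℝ] EuclideanSpace ℝ (Fin (Module.finrank ℝ F)))‖ * |M| + 1)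
  have hN : 0 < N := by positivity
  obtain ⟨x, hx⟩ := ls_brouwer (fun x => N⁻¹ • e (g (e.symm (N • x)))) (by fun_prop) (by
    intro x
    rw [norm_smul, norm_inv, Real.norm_eq_abs, abs_of_pos hN, inv_mul_le_iff₀ hN]
    have h1 := (e : F →L[ℝ] EuclideanSpace ℝ (Fin (Module.finrank ℝ F))).le_opNorm (g (e.symm (N • x)))
    have h2 : ‖(e : F →L[ℝ] EuclideanSpace ℝ (Fin (Module.finrank ℝ F)))‖ * ‖g (e.symm (N • x))‖ ≤ ‖(e : F →L[ℝ] EuclideanSpace ℝ (Fin (Module.finrank ℝ F)))‖ * |M| := by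
      gcongr
      exact (hgM _).trans (le_abs_self M)
    have h3 := h1.trans h2
    simp only [ContinuousLinearEquiv.coe_coe] at h3
    simp only [N]
    linarith)
  refine ⟨e.symm (N • x), ?_⟩
  have h1 : e (g (e.symm (N • x))) = N • x := by
    conv_rhs => rw [← hx]
    rw [smul_inv_smul₀ hN.ne']
  exact (e.symm_apply_eq.2 h1.symm).symm

theorem ls_schauder_approx {X : Type*} [NormedAddCommGroup X] [NormedSpace ℝ X]
    (T : X → X) (hT : Continuous T) (K : Set X) (hK : IsCompact K) (hTK : ∀ x, T x ∈ K)
    (ε : ℝ) (hε : 0 < ε) : ∃ x, ‖T x - x‖ ≤ ε := by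
  classical
  obtain ⟨t, htK, htf, htc⟩ := hK.finite_cover_balls hε
  lift t to Finset X using htf
  let F := Submodule.span ℝ (t : Set X)
  have : FiniteDimensional ℝ F := FiniteDimensional.span_finset ℝ t
  let w : X → X → ℝ := fun i y => max 0 (ε - ‖y - i‖)
  have hw0 : ∀ i y, 0 ≤ w i y := fun i y => le_max_left _ _
  have hwc : ∀ i, Continuous (w i) := fun i => by fun_prop
  let W : X → ℝ := fun y => ∑ i ∈ t, w i y
  have hWc : Continuous W := continuous_finsetSum _ fun i _ => hwc i
  have hW : ∀ y ∈ K, 0 < W y := by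
    intro y hy
    have := htc hy
    simp only [Set.mem_iUnion, Metric.mem_ball, dist_eq_norm] at this
    obtain ⟨i, hi, hyi⟩ := this
    refine Finset.sum_pos' (fun j _ => hw0 j y) ⟨i, hi, ?_⟩
    exact lt_max_of_lt_right (by linarith)
  let q : t → F := fun i => ⟨i, Submodule.subset_span i.2⟩
  let P : X → F := fun y => (W y)⁻¹ • ∑ i : t, w i y • q i
  have hPv : ∀ y, (P y : X) = (W y)⁻¹ • ∑ i ∈ t, w i y • i := by
    intro y
    simp only [P, q, Submodule.coe_smul, Submodule.coe_sum]
    rw [Finset.sum_coe_sort t (fun i => w i y • i)]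
  have hPe : ∀ y ∈ K, ‖(P y : X) - y‖ ≤ ε := by
    intro y hy
    have hWy := hW y hy
    have h1 : (P y : X) - y = (W y)⁻¹ • ∑ i ∈ t, w i y • (i - y) := by
      rw [hPv]
      simp_rw [smul_sub]
      rw [Finset.sum_sub_distrib, smul_sub, ← Finset.sum_smul, inv_smul_smul₀ hWy.ne']
    rw [h1, norm_smul, norm_inv, Real.norm_eq_abs, abs_of_pos hWy, inv_mul_le_iff₀ hWy]
    refine (norm_sum_le _ _).trans ?_
    rw [Finset.sum_mul]
    refine Finset.sum_le_sum fun i _ => ?_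
    rw [norm_smul, Real.norm_eq_abs, abs_of_nonneg (hw0 i y)]
    rcases le_or_gt ‖y - i‖ ε with h | h
    · rw [norm_sub_rev]
      exact mul_le_mul_of_nonneg_left h (hw0 i y)
    · have : w i y = 0 := max_eq_left (by linarith)
      simp [this]
  obtain ⟨C, hC⟩ := hK.isBounded.exists_norm_le
  have hφc : Continuous (fun x : F => P (T x)) := by
    have h1 : Continuous (fun x : F => T x) := hT.comp continuous_subtype_val
    refine Continuous.smul ((hWc.comp h1).inv₀ fun x => (hW _ (hTK x)).ne') ?_
    exact continuous_finsetSum _ fun i _ => ((hwc i).comp h1).smul continuous_const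
  obtain ⟨x, hx⟩ := ls_brouwer' (fun x : F => P (T x)) hφc (C + ε) (by
    intro x
    have h1 := hPe _ (hTK x)
    have h2 := hC _ (hTK x)
    have h3 := norm_le_norm_add_norm_sub' (P (T x) : X) (T x)
    change ‖(P (T x) : X)‖ ≤ C + ε
    linarith)
  refine ⟨x, ?_⟩
  have h1 := hPe _ (hTK x)
  have h2 : (P (T x) : X) = x := congrArg Subtype.val hx
  rw [h2, norm_sub_rev] at h1
  exact h1

theorem ls_schauder {X : Type*} [NormedAddCommGroup X] [NormedSpace ℝ X]
    (T : X → X) (hT : Continuous T) (K : Set X) (hK : IsCompact K) (hTK : ∀ x, T x ∈ K) :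
    ∃ x, T x = x := by
  choose x hx using fun n : ℕ => ls_schauder_approx T hT K hK hTK (1 / ((n:ℝ) + 1)) (by positivity)
  obtain ⟨y, -, φ, hφ, hlim⟩ := hK.tendsto_subseq (fun n => hTK (x n))
  have h0 : Filter.Tendsto (fun n => T (x n) - x n) Filter.atTop (nhds 0) :=
    squeeze_zero_norm hx tendsto_one_div_add_atTop_nhds_zero_nat
  have h1 := hlim.sub (h0.comp hφ.tendsto_atTop)
  have h2 : Filter.Tendsto (fun n => x (φ n)) Filter.atTop (nhds y) := by
    simpa [Function.comp_def] using h1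
  exact ⟨y, tendsto_nhds_unique ((hT.tendsto y).comp h2) hlim⟩

/-- Leray–Schauder alternative: let `X` be a real Banach space and
`A : X → X` a compact (completely continuous) operator, i.e. continuous and mapping
bounded sets to relatively compact sets. If the set `S = {u | A u = λ u for some λ > 1}`
is bounded, then `A` has a fixed point. -/
theorem leray_schauder_alternative (X : Type*) [NormedAddCommGroup X] [NormedSpace ℝ X]
    [CompleteSpace X] (A : X → X)
    (hcont : Continuous A)
    (hcpt : ∀ s : Set X, Bornology.IsBounded s → IsCompact (closure (A '' s)))
    (hS : Bornology.IsBounded {u : X | ∃ l : ℝ, 1 < l ∧ A u = l • u}) :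
    ∃ u : X, A u = u := by
  obtain ⟨C, hC⟩ := hS.exists_norm_le
  let R : ℝ := |C| + 1
  have hR : 0 < R := by positivity
  have hCR : C < R := lt_of_le_of_lt (le_abs_self C) (lt_add_one _)
  -- radial retraction onto the closed ball of radius `R`
  let ρ : X → X := fun y => (R / max R ‖y‖) • y
  have hmax : ∀ y : X, 0 < max R ‖y‖ := fun y => lt_max_of_lt_left hR
  have hρc : Continuous ρ :=
    (continuous_const.div (by fun_prop) fun y => (hmax y).ne').smul continuous_id
  have hρn : ∀ y, ‖ρ y‖ ≤ R := by
    intro y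
    simp only [ρ]
    rw [norm_smul, Real.norm_eq_abs, abs_of_pos (div_pos hR (hmax y)), div_mul_eq_mul_div,
      div_le_iff₀ (hmax y)]
    gcongr
    exact le_max_right _ _
  have hK := hcpt (Metric.closedBall 0 R) Metric.isBounded_closedBall
  -- `A ∘ ρ` has relatively compact range
  obtain ⟨y, hy⟩ := ls_schauder (fun y => A (ρ y)) (hcont.comp hρc) _ hK
    (fun y => subset_closure ⟨ρ y, by simpa using hρn y, rfl⟩)
  rcases le_or_gt ‖y‖ R with h | h
  · have : ρ y = y := by simp [ρ, max_eq_left h, hR.ne']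
    exact ⟨y, by rw [this] at hy; exact hy⟩
  · exfalso
    have hy0 : 0 < ‖y‖ := hR.trans h
    have h1 : ρ y = (R / ‖y‖) • y := by simp [ρ, max_eq_right h.le]
    have h2 : A (ρ y) = (‖y‖ / R) • ρ y := by
      rw [hy, h1, smul_smul, div_mul_div_cancel₀ hR.ne', div_self hy0.ne', one_smul]
    have h3 := hC (ρ y) ⟨‖y‖ / R, (one_lt_div hR).2 h, h2⟩
    rw [h1, norm_smul, Real.norm_eq_abs, abs_of_pos (div_pos hR hy0),
      div_mul_cancel₀ _ hy0.ne'] at h3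
    linarith
end
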